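/- (Theorem 1, part 1: left-equivariance of the weighted quaternion mean) Let q₁, …, q_Q ∈ ℍ be unit quaternions, w₁, …, w_Q nonnegative weights, and g a unit quaternion. A unit quaternion x̄ maximizes f(x) = Σᵢ wᵢ · ⟪qᵢ, x⟫² over the unit sphere {x ∈ ℍ : ‖x‖ = 1} if and only if g * x̄ maximizes f_g(x) = Σᵢ wᵢ · ⟪g * qᵢ, x⟫² over the unit sphere. In particular, the set of weighted quaternion means of the rotated set {g * qᵢ} equals g applied to the set of weighted quaternion means of {qᵢ}. -/

import Mathlib

open scoped Quaternion RealInnerProductSpace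

/-- Left multiplication by a quaternion `g` scales the inner product by `‖g‖ ^ 2`. -/
theorem Quaternion.inner_mul_left_mul_left (g a b : ℍ[ℝ]) :
    ⟪g * a, g * b⟫ = ‖g‖ ^ 2 * ⟪a, b⟫ := by
  rw [sq, ← Quaternion.normSq_eq_norm_mul_self, Quaternion.normSq_def']
  simp only [Quaternion.inner_def, Quaternion.re_mul, Quaternion.imI_mul, Quaternion.imJ_mul,
    Quaternion.imK_mul, Quaternion.re_star, Quaternion.imI_star, Quaternion.imJ_star,
    Quaternion.imK_star]
  ring

/-- Left multiplication by a unit quaternion carries maximizers of the weighted quaternion-mean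
objective on the unit sphere to maximizers of the rotated objective. -/
theorem Quaternion.isMaxOn_weighted_inner_sq_mul_left_iff {ι : Type*} [Fintype ι]
    {g : ℍ[ℝ]} (hg : ‖g‖ = 1) (q : ι → ℍ[ℝ]) (w : ι → ℝ) (x : ℍ[ℝ]) :
    IsMaxOn (fun x => ∑ i, w i * ⟪q i, x⟫ ^ 2) {x : ℍ[ℝ] | ‖x‖ = 1} x ↔
      IsMaxOn (fun x => ∑ i, w i * ⟪g * q i, x⟫ ^ 2) {x : ℍ[ℝ] | ‖x‖ = 1} (g * x) := by
  have hg0 : g ≠ 0 := norm_ne_zero_iff.mp (by simp [hg])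
  simp only [isMaxOn_iff, Set.mem_ofPred_eq]
  constructor
  · intro h y hy
    have := h (g⁻¹ * y) (by simp [hg, hy])
    rw [← mul_inv_cancel_left₀ hg0 y]
    simpa only [Quaternion.inner_mul_left_mul_left, hg, one_pow, one_mul] using this
  · intro h y hy
    simpa only [Quaternion.inner_mul_left_mul_left, hg, one_pow, one_mul]
      using h (g * y) (by simp [hg, hy])

/-- (Theorem 1, part 1: left-equivariance of the weighted quaternion mean)
A unit quaternion `xbar` maximizes `f(x) = Σᵢ wᵢ ⟪qᵢ, x⟫²` over the unit sphere
iff `g * xbar` maximizes `f_g(x) = Σᵢ wᵢ ⟪g * qᵢ, x⟫²` over the unit sphere;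
consequently the set of weighted means of `{g * qᵢ}` is the image under
`(g * ·)` of the set of weighted means of `{qᵢ}`. -/
theorem weighted_quaternion_mean_left_equivariant
    (Q : ℕ) (g : ℍ[ℝ]) (hg : ‖g‖ = 1)
    (q : Fin Q → ℍ[ℝ]) (hq : ∀ i, ‖q i‖ = 1)
    (w : Fin Q → ℝ) (hw : ∀ i, 0 ≤ w i) :
    (∀ xbar : ℍ[ℝ], ‖xbar‖ = 1 →
      (IsMaxOn (fun x => ∑ i, w i * ⟪q i, x⟫ ^ 2) {x : ℍ[ℝ] | ‖x‖ = 1} xbar ↔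
       IsMaxOn (fun x => ∑ i, w i * ⟪g * q i, x⟫ ^ 2) {x : ℍ[ℝ] | ‖x‖ = 1}
         (g * xbar))) ∧
    {y : ℍ[ℝ] | ‖y‖ = 1 ∧
        IsMaxOn (fun x => ∑ i, w i * ⟪g * q i, x⟫ ^ 2) {x : ℍ[ℝ] | ‖x‖ = 1} y}
      = (fun xbar => g * xbar) ''
        {xbar : ℍ[ℝ] | ‖xbar‖ = 1 ∧
          IsMaxOn (fun x => ∑ i, w i * ⟪q i, x⟫ ^ 2) {x : ℍ[ℝ] | ‖x‖ = 1} xbar} := by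
  refine ⟨fun x _ => Quaternion.isMaxOn_weighted_inner_sq_mul_left_iff hg q w x, ?_⟩
  have hg0 : g ≠ 0 := norm_ne_zero_iff.mp (by simp [hg])
  ext y
  constructor
  · rintro ⟨hy, hmax⟩
    refine ⟨g⁻¹ * y, ⟨by simp [hg, hy], ?_⟩, mul_inv_cancel_left₀ hg0 y⟩
    rwa [Quaternion.isMaxOn_weighted_inner_sq_mul_left_iff hg, mul_inv_cancel_left₀ hg0]
  · rintro ⟨x, ⟨hx, hmax⟩, rfl⟩
    exact ⟨by simp [hg, hx], (Quaternion.isMaxOn_weighted_inner_sq_mul_left_iff hg q w x).mp hmax⟩
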